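/- arXiv:2401.10856 — 3 statements merged into one kernel-verified Lean document; each statement's English description precedes it below -/
import Mathlib

section
/- Assume λ > 0. Let 𝒞 be the collection of all mincuts X with r ∉ X such that either X has no chain certificate, or every chain whose union equals X is a maximal chain. Then 𝒞 is laminar: for all A, B ∈ 𝒞, either A ⊆ B, or B ⊆ A, or A ∩ B = ∅. -/
open Finset

variable {V : Type*} [Fintype V] [DecidableEq V]

/-- `cutW w X Y` is `C(X,Y) = Σ_{x∈X} Σ_{y∈Y} w(x,y)`. -/
def cutW (w : V → V → ℝ) (X Y : Finset V) : ℝ := ∑ x ∈ X, ∑ y ∈ Y, w x y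

/-- `C(X) := C(X, V ∖ X)`. -/
def cutVal (w : V → V → ℝ) (X : Finset V) : ℝ := cutW w X Xᶜ

/-- A cut is a nonempty proper subset of `V`. -/
def IsCut (X : Finset V) : Prop := X.Nonempty ∧ X ≠ Finset.univ

/-- A mincut is a cut of minimum weight. -/
def IsMincut (w : V → V → ℝ) (X : Finset V) : Prop :=
  IsCut X ∧ ∀ Y : Finset V, IsCut Y → cutVal w X ≤ cutVal w Y

/-- `X` and `Y` cross if `X∩Y`, `X∖Y`, `Y∖X` and `V∖(X∪Y)` are all nonempty. -/
def Crosses (X Y : Finset V) : Prop :=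
  (X ∩ Y).Nonempty ∧ (X \ Y).Nonempty ∧ (Y \ X).Nonempty ∧ ((X ∪ Y)ᶜ).Nonempty

/-- A minimal mincut of a vertex `v`: a mincut containing `v` but not the root `r`,
of minimum cardinality among all such mincuts. -/
def IsMinimalMincutOfVertex (w : V → V → ℝ) (r v : V) (X : Finset V) : Prop :=
  IsMincut w X ∧ v ∈ X ∧ r ∉ X ∧
    ∀ Y : Finset V, IsMincut w Y → v ∈ Y → r ∉ Y → X.card ≤ Y.card

/-- An edge is an unordered pair of distinct vertices with positive weight. -/
def IsEdge (w : V → V → ℝ) (u₁ u₂ : V) : Prop := u₁ ≠ u₂ ∧ 0 < w u₁ u₂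

/-- A minimal mincut of an edge `{u₁,u₂}`: a mincut containing both endpoints but not the
root `r`, of minimum cardinality among all such mincuts. -/
def IsMinimalMincutOfEdge (w : V → V → ℝ) (r u₁ u₂ : V) (X : Finset V) : Prop :=
  IsEdge w u₁ u₂ ∧ IsMincut w X ∧ u₁ ∈ X ∧ u₂ ∈ X ∧ r ∉ X ∧
    ∀ Y : Finset V, IsMincut w Y → u₁ ∈ Y → u₂ ∈ Y → r ∉ Y → X.card ≤ Y.card

/-- Union of the members of a chain. -/
def chainUnion (C : List (Finset V)) : Finset V := C.foldr (· ∪ ·) ∅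

/-- `X ⊆ V∖{r}` has a certificate if it is the minimal mincut of some vertex,
the minimal mincut of some edge, or the union of a chain, where a chain is a sequence
`(C₀,…,C_ℓ)` (`ℓ ≥ 1`) of pairwise disjoint nonempty subsets of `V∖{r}` such that every
`C_i` has a certificate and each `C_i ∪ C_{i+1}` is the minimal mincut of some edge. -/
inductive HasCert (w : V → V → ℝ) (r : V) : Finset V → Prop
  | vertex {v : V} {X : Finset V} : IsMinimalMincutOfVertex w r v X → HasCert w r X
  | edge {u₁ u₂ : V} {X : Finset V} : IsMinimalMincutOfEdge w r u₁ u₂ X → HasCert w r X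
  | chain {C : List (Finset V)} :
      2 ≤ C.length →
      (∀ A ∈ C, A.Nonempty) →
      (∀ A ∈ C, r ∉ A) →
      C.Pairwise (fun A B => Disjoint A B) →
      (∀ A ∈ C, HasCert w r A) →
      (∀ i (h : i + 1 < C.length),
        ∃ u₁ u₂, IsMinimalMincutOfEdge w r u₁ u₂
          (C.get ⟨i, Nat.lt_of_succ_lt h⟩ ∪ C.get ⟨i + 1, h⟩)) →
      HasCert w r (chainUnion C)

/-- `(C₀,…,C_ℓ)` with `ℓ ≥ 1` is a chain. -/
def IsMincutChain (w : V → V → ℝ) (r : V) (C : List (Finset V)) : Prop :=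
  2 ≤ C.length ∧
  (∀ A ∈ C, A.Nonempty) ∧
  (∀ A ∈ C, r ∉ A) ∧
  C.Pairwise (fun A B => Disjoint A B) ∧
  (∀ A ∈ C, HasCert w r A) ∧
  (∀ i (h : i + 1 < C.length),
    ∃ u₁ u₂, IsMinimalMincutOfEdge w r u₁ u₂
      (C.get ⟨i, Nat.lt_of_succ_lt h⟩ ∪ C.get ⟨i + 1, h⟩))

/-- A subchain is a consecutive subsequence of a chain or of its reversal. -/
def IsSubchain (D C : List (Finset V)) : Prop := D <:+: C ∨ D <:+: C.reverse

/-- A maximal chain is a chain that is not a subchain of any strictly longer chain. -/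
def IsMaximalMincutChain (w : V → V → ℝ) (r : V) (C : List (Finset V)) : Prop :=
  IsMincutChain w r C ∧
    ¬ ∃ D : List (Finset V), IsMincutChain w r D ∧ C.length < D.length ∧ IsSubchain C D

/-- `lam` is the minimum weight of a cut. -/
def IsMincutValue (w : V → V → ℝ) (lam : ℝ) : Prop :=
  (∃ X : Finset V, IsCut X ∧ cutVal w X = lam) ∧
  ∀ X : Finset V, IsCut X → lam ≤ cutVal w X

/-- The standing assumptions. -/
structure Hyp (w : V → V → ℝ) (r : V) (lam : ℝ) : Prop where
  sym : ∀ x y, w x y = w y x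
  nonneg : ∀ x y, 0 ≤ w x y
  pos : 0 < lam
  le : ∀ X : Finset V, X.Nonempty → r ∉ X → lam ≤ cutVal w X
  mc : ∀ X : Finset V, r ∉ X → (IsMincut w X ↔ X.Nonempty ∧ cutVal w X = lam)

/-- Mincut avoiding the root. -/
def MC (w : V → V → ℝ) (r : V) (lam : ℝ) (X : Finset V) : Prop :=
  X.Nonempty ∧ r ∉ X ∧ cutVal w X = lam

theorem hyp_of (r : V) (w : V → V → ℝ) (hsym : ∀ x y, w x y = w y x)
    (hnonneg : ∀ x y, 0 ≤ w x y) (lam : ℝ) (hlam : IsMincutValue w lam) (hpos : 0 < lam) :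
    Hyp w r lam := by
  obtain ⟨⟨Z, hZ, hZl⟩, hmin⟩ := hlam
  have hc : ∀ X : Finset V, r ∉ X → X ≠ Finset.univ := by
    rintro X h rfl; exact h (Finset.mem_univ _)
  refine ⟨hsym, hnonneg, hpos, fun X h1 h2 => hmin X ⟨h1, hc X h2⟩, fun X hr => ⟨?_, ?_⟩⟩
  · rintro ⟨h1, h2⟩
    exact ⟨h1.1, le_antisymm (hZl ▸ h2 Z hZ) (hmin X h1)⟩
  · rintro ⟨h1, h2⟩
    exact ⟨⟨h1, hc X hr⟩, fun Y hY => h2 ▸ hmin Y hY⟩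

theorem cutW_nonneg {w : V → V → ℝ} {r : V} {lam : ℝ} (H : Hyp w r lam) (X Y : Finset V) :
    0 ≤ cutW w X Y :=
  Finset.sum_nonneg fun x _ => Finset.sum_nonneg fun y _ => H.nonneg x y

theorem cutW_symm {w : V → V → ℝ} {r : V} {lam : ℝ} (H : Hyp w r lam) (X Y : Finset V) :
    cutW w X Y = cutW w Y X := by
  unfold cutW
  rw [Finset.sum_comm]
  simp only [H.sym]

theorem cutW_union_left (w : V → V → ℝ) {X Y : Finset V} (Z : Finset V) (h : Disjoint X Y) :
    cutW w (X ∪ Y) Z = cutW w X Z + cutW w Y Z := Finset.sum_union h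

theorem cutW_union_right (w : V → V → ℝ) {X Y : Finset V} (Z : Finset V) (h : Disjoint X Y) :
    cutW w Z (X ∪ Y) = cutW w Z X + cutW w Z Y := by
  unfold cutW
  rw [← Finset.sum_add_distrib]
  exact Finset.sum_congr rfl fun x _ => Finset.sum_union h

theorem cutW_mono_right {w : V → V → ℝ} {r : V} {lam : ℝ} (H : Hyp w r lam)
    (X : Finset V) {Y Z : Finset V} (h : Y ⊆ Z) : cutW w X Y ≤ cutW w X Z :=
  Finset.sum_le_sum fun x _ => Finset.sum_le_sum_of_subset_of_nonneg h fun y _ _ => H.nonneg x y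

theorem cutW_le_cutVal {w : V → V → ℝ} {r : V} {lam : ℝ} (H : Hyp w r lam)
    {X Y : Finset V} (h : Disjoint X Y) : cutW w X Y ≤ cutVal w X :=
  cutW_mono_right H X (by
    intro y hy
    rw [Finset.mem_compl]
    exact fun hx => (Finset.disjoint_left.1 h hx hy))

theorem cutVal_union {w : V → V → ℝ} {r : V} {lam : ℝ} (H : Hyp w r lam)
    {X Y : Finset V} (h : Disjoint X Y) :
    cutVal w (X ∪ Y) = cutVal w X + cutVal w Y - 2 * cutW w X Y := by
  have h1 : Xᶜ = (X ∪ Y)ᶜ ∪ Y := by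
    ext a; have : a ∈ X → a ∉ Y := fun h' => Finset.disjoint_left.1 h h'; simp; tauto
  have h2 : Yᶜ = (X ∪ Y)ᶜ ∪ X := by
    ext a; have : a ∈ X → a ∉ Y := fun h' => Finset.disjoint_left.1 h h'; simp; tauto
  have d1 : Disjoint (X ∪ Y)ᶜ Y := by
    rw [Finset.disjoint_left]; intro a; simp
  have d2 : Disjoint (X ∪ Y)ᶜ X := by
    rw [Finset.disjoint_left]; intro a; simp; tauto
  have e1 : cutVal w X = cutW w X (X ∪ Y)ᶜ + cutW w X Y := by
    rw [← cutW_union_right w X d1, ← h1]; rfl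
  have e2 : cutVal w Y = cutW w Y (X ∪ Y)ᶜ + cutW w Y X := by
    rw [← cutW_union_right w Y d2, ← h2]; rfl
  have e3 : cutVal w (X ∪ Y) = cutW w X (X ∪ Y)ᶜ + cutW w Y (X ∪ Y)ᶜ :=
    cutW_union_left w _ h
  have := cutW_symm H X Y
  linarith

theorem MC.half {w : V → V → ℝ} {r : V} {lam : ℝ} (H : Hyp w r lam) {P Q : Finset V}
    (hP : MC w r lam P) (hQ : MC w r lam Q) (hd : Disjoint P Q) (hPQ : MC w r lam (P ∪ Q)) :
    cutW w P Q = lam / 2 := by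
  have := cutVal_union H hd
  rw [hP.2.2, hQ.2.2, hPQ.2.2] at this
  linarith

theorem MC.union_of_half {w : V → V → ℝ} {r : V} {lam : ℝ} (H : Hyp w r lam) {P Q : Finset V}
    (hP : MC w r lam P) (hQ : MC w r lam Q) (hd : Disjoint P Q) (h : lam / 2 ≤ cutW w P Q) :
    MC w r lam (P ∪ Q) := by
  have h1 := cutVal_union H hd
  have hne : (P ∪ Q).Nonempty := hP.1.mono Finset.subset_union_left
  have hr : r ∉ P ∪ Q := by simp [hP.2.1, hQ.2.1]
  have h2 := H.le _ hne hr
  have h3 := hP.2.2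
  have h4 := hQ.2.2
  exact ⟨hne, hr, by linarith⟩

theorem MC.cross {w : V → V → ℝ} {r : V} {lam : ℝ} (H : Hyp w r lam) {X Y : Finset V}
    (hX : MC w r lam X) (hY : MC w r lam Y) (h1 : (X ∩ Y).Nonempty) (h2 : (X \ Y).Nonempty)
    (h3 : (Y \ X).Nonempty) :
    MC w r lam (X ∩ Y) ∧ MC w r lam (X \ Y) ∧ MC w r lam (Y \ X) ∧ MC w r lam (X ∪ Y) ∧
    cutW w (X ∩ Y) (X \ Y) = lam / 2 ∧ cutW w (X ∩ Y) (Y \ X) = lam / 2 := by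
  have hr1 : r ∉ X ∩ Y := by simp [hX.2.1]
  have hr2 : r ∉ X \ Y := by simp [hX.2.1]
  have hr3 : r ∉ Y \ X := by simp [hY.2.1]
  have hr4 : r ∉ X ∪ Y := by simp [hX.2.1, hY.2.1]
  have h4 : (X ∪ Y).Nonempty := hX.1.mono Finset.subset_union_left
  have dab : Disjoint (X ∩ Y) (X \ Y) := by
    rw [Finset.disjoint_left]; intro a; simp; tauto
  have dac : Disjoint (X ∩ Y) (Y \ X) := by
    rw [Finset.disjoint_left]; intro a; simp; tauto
  have dbc : Disjoint (X \ Y) (Y \ X) := by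
    rw [Finset.disjoint_left]; intro a; simp; tauto
  have dXc : Disjoint X (Y \ X) := by
    rw [Finset.disjoint_left]; intro a; simp; tauto
  have dabc : Disjoint (X ∩ Y) ((X \ Y) ∪ (Y \ X)) := Finset.disjoint_union_right.2 ⟨dab, dac⟩
  have eX : X ∩ Y ∪ X \ Y = X := by ext a; simp; tauto
  have eY : X ∩ Y ∪ Y \ X = Y := by ext a; simp; tauto
  have eXY : X ∪ Y \ X = X ∪ Y := by ext a; simp
  have c1 := cutVal_union H dab
  have c2 := cutVal_union H dac
  have c3 := cutVal_union H dXc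
  have c4 := cutW_union_left w (Y \ X) dab
  have c5 := cutW_le_cutVal H dabc
  rw [cutW_union_right w _ dbc] at c5
  rw [eX] at c1 c4
  rw [eY] at c2
  rw [eXY] at c3
  have n1 := cutW_nonneg H (X \ Y) (Y \ X)
  have l1 := H.le _ h1 hr1
  have l2 := H.le _ h2 hr2
  have l3 := H.le _ h3 hr3
  have l4 := H.le _ h4 hr4
  have v1 := hX.2.2
  have v2 := hY.2.2
  refine ⟨⟨h1, hr1, ?_⟩, ⟨h2, hr2, ?_⟩, ⟨h3, hr3, ?_⟩, ⟨h4, hr4, ?_⟩, ?_, ?_⟩ <;> linarith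

/-- Intersecting mincuts have a mincut as intersection. -/
theorem MC.inter {w : V → V → ℝ} {r : V} {lam : ℝ} (H : Hyp w r lam) {X Y : Finset V}
    (hX : MC w r lam X) (hY : MC w r lam Y) (h1 : (X ∩ Y).Nonempty) : MC w r lam (X ∩ Y) := by
  by_cases h2 : (X \ Y).Nonempty
  · by_cases h3 : (Y \ X).Nonempty
    · exact (MC.cross H hX hY h1 h2 h3).1
    · rw [Finset.not_nonempty_iff_eq_empty, Finset.sdiff_eq_empty_iff_subset] at h3
      rwa [Finset.inter_eq_right.2 h3]
  · rw [Finset.not_nonempty_iff_eq_empty, Finset.sdiff_eq_empty_iff_subset] at h2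
    rwa [Finset.inter_eq_left.2 h2]

theorem split_part {w : V → V → ℝ} {r : V} {lam : ℝ} (H : Hyp w r lam) {P Q X : Finset V}
    (hP : MC w r lam P) (hQ : MC w r lam Q) (hd : Disjoint P Q)
    (hX : MC w r lam X) (hXs : X ⊆ P ∪ Q)
    (h1 : (P ∩ X).Nonempty) (h2 : (X \ P).Nonempty) (h3 : (P \ X).Nonempty) :
    MC w r lam (P \ X) ∧ MC w r lam (P ∩ X) ∧ MC w r lam ((P ∩ X) ∪ Q) ∧
    ∀ P', MC w r lam P' → Disjoint P' P → Disjoint P' Q → MC w r lam (P' ∪ P) →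
      MC w r lam (P' ∪ (P \ X)) := by
  obtain ⟨m1, m2, m3, m4, c1, c2⟩ := MC.cross H hP hX h1 h3 h2
  have hXQ : X \ P ⊆ Q := by
    intro a ha
    have := @hXs a
    simp at this ha
    tauto
  have dQ : Disjoint (P ∩ X) Q := hd.mono_left Finset.inter_subset_left
  have c3 : lam / 2 ≤ cutW w (P ∩ X) Q := c2 ▸ cutW_mono_right H (P ∩ X) hXQ
  refine ⟨m2, m1, MC.union_of_half H m1 hQ dQ c3, ?_⟩
  intro P' hP' d1 d2 hU
  have dd : Disjoint (P ∩ X) (P \ X) := by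
    rw [Finset.disjoint_left]; intro a; simp; tauto
  have d3 : Disjoint (P \ X) Q := hd.mono_left Finset.sdiff_subset
  have d4 : Disjoint P' (P \ X) := d1.mono_right Finset.sdiff_subset
  have d5 : Disjoint P' (P ∩ X) := d1.mono_right Finset.inter_subset_left
  have d6 : Disjoint (P \ X ∪ Q) P' := Finset.disjoint_union_left.2 ⟨d4.symm, d2.symm⟩
  have d7 : Disjoint (P ∩ X) (P \ X ∪ Q ∪ P') :=
    Finset.disjoint_union_right.2 ⟨Finset.disjoint_union_right.2 ⟨dd, dQ⟩, d5.symm⟩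
  have k := cutW_le_cutVal H d7
  rw [cutW_union_right w _ d6, cutW_union_right w _ d3, m1.2.2] at k
  have k2 := MC.half H hP' hP d1 hU
  have eP : P ∩ X ∪ P \ X = P := by ext a; simp; tauto
  have k3 := cutW_union_right w P' dd
  rw [eP] at k3
  have k4 := cutW_symm H P' (P ∩ X)
  exact MC.union_of_half H hP' m2 d4 (by linarith)

/-- The union of the two sets is the minimal mincut of some edge. -/
def EdgeRel (w : V → V → ℝ) (r : V) (P Q : Finset V) : Prop :=
  ∃ u₁ u₂, IsMinimalMincutOfEdge w r u₁ u₂ (P ∪ Q)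

theorem exists_edge {w : V → V → ℝ} {r : V} {lam : ℝ} (H : Hyp w r lam) {P Q : Finset V}
    (hd : Disjoint P Q) (h : 0 < cutW w P Q) : ∃ u ∈ P, ∃ v ∈ Q, IsEdge w u v := by
  by_contra hc
  push Not at hc
  have : cutW w P Q ≤ 0 := by
    refine Finset.sum_nonpos fun x hx => Finset.sum_nonpos fun y hy => ?_
    by_contra h0
    refine hc x hx y hy ⟨?_, not_le.1 h0⟩
    rintro rfl
    exact Finset.disjoint_left.1 hd hx hy
  linarith

/-- If `X` is not the minimal mincut of an edge inside, a proper sub-mincut contains it. -/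
theorem exists_smaller_edge {w : V → V → ℝ} {r : V} {lam : ℝ} (H : Hyp w r lam) {X : Finset V}
    {u v : V} (hX : MC w r lam X) (hu : u ∈ X) (hv : v ∈ X) (he : IsEdge w u v)
    (hn : ¬ IsMinimalMincutOfEdge w r u v X) :
    ∃ Y, MC w r lam Y ∧ Y ⊂ X ∧ u ∈ Y ∧ v ∈ Y := by
  by_contra hc
  push Not at hc
  refine hn ⟨he, (H.mc X hX.2.1).2 ⟨hX.1, hX.2.2⟩, hu, hv, hX.2.1, ?_⟩
  intro Y hY hu' hv' hr
  have hY' : MC w r lam Y := ⟨⟨u, hu'⟩, hr, ((H.mc Y hr).1 hY).2⟩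
  have hI := MC.inter H hX hY' ⟨u, Finset.mem_inter.2 ⟨hu, hu'⟩⟩
  by_cases hs : X ∩ Y = X
  · exact Finset.card_le_card (Finset.inter_eq_left.1 hs)
  · exact absurd (Finset.mem_inter.2 ⟨hv, hv'⟩) (hc _ hI
      (Finset.ssubset_iff_subset_ne.2 ⟨Finset.inter_subset_left, hs⟩)
      (Finset.mem_inter.2 ⟨hu, hu'⟩))

theorem exists_smaller_vertex {w : V → V → ℝ} {r : V} {lam : ℝ} (H : Hyp w r lam) {X : Finset V}
    {u : V} (hX : MC w r lam X) (hu : u ∈ X)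
    (hn : ¬ IsMinimalMincutOfVertex w r u X) :
    ∃ Y, MC w r lam Y ∧ Y ⊂ X := by
  by_contra hc
  push Not at hc
  refine hn ⟨(H.mc X hX.2.1).2 ⟨hX.1, hX.2.2⟩, hu, hX.2.1, ?_⟩
  intro Y hY hu' hr
  have hY' : MC w r lam Y := ⟨⟨u, hu'⟩, hr, ((H.mc Y hr).1 hY).2⟩
  have hI := MC.inter H hX hY' ⟨u, Finset.mem_inter.2 ⟨hu, hu'⟩⟩
  by_cases hs : X ∩ Y = X
  · exact Finset.card_le_card (Finset.inter_eq_left.1 hs)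
  · exact absurd (Finset.ssubset_iff_subset_ne.2 ⟨Finset.inter_subset_left, hs⟩) (hc _ hI)

/-- Local refinement: a pair that is not an edge certificate can be refined on one side. -/
theorem refine_pair {w : V → V → ℝ} {r : V} {lam : ℝ} (H : Hyp w r lam) {P Q : Finset V}
    (hP : MC w r lam P) (hQ : MC w r lam Q) (hd : Disjoint P Q) (hPQ : MC w r lam (P ∪ Q))
    (hn : ¬ EdgeRel w r P Q) :
    (∃ P₁ P₂, P₁ ∪ P₂ = P ∧ Disjoint P₁ P₂ ∧ MC w r lam P₁ ∧ MC w r lam P₂ ∧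
      MC w r lam (P₂ ∪ Q) ∧
      ∀ P', MC w r lam P' → Disjoint P' P → Disjoint P' Q → MC w r lam (P' ∪ P) →
        MC w r lam (P' ∪ P₁)) ∨
    (∃ Q₁ Q₂, Q₁ ∪ Q₂ = Q ∧ Disjoint Q₁ Q₂ ∧ MC w r lam Q₁ ∧ MC w r lam Q₂ ∧
      MC w r lam (P ∪ Q₁) ∧
      ∀ Q', MC w r lam Q' → Disjoint Q Q' → Disjoint P Q' → MC w r lam (Q ∪ Q') →
        MC w r lam (Q₂ ∪ Q')) := by
  have hh := MC.half H hP hQ hd hPQ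
  obtain ⟨u, hu, v, hv, he⟩ := exists_edge H hd (by rw [hh]; linarith [H.pos])
  obtain ⟨X, hX, hXs, huX, hvX⟩ := exists_smaller_edge H hPQ
    (Finset.mem_union_left _ hu) (Finset.mem_union_right _ hv) he (fun h => hn ⟨u, v, h⟩)
  have huQ : u ∉ Q := Finset.disjoint_left.1 hd hu
  have hvP : v ∉ P := Finset.disjoint_right.1 hd hv
  by_cases hPX : P ⊆ X
  · right
    have hQX : (Q \ X).Nonempty := by
      rw [Finset.sdiff_nonempty]
      exact fun h => hXs.2 (Finset.union_subset hPX h)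
    obtain ⟨a1, a2, a3, a4⟩ := split_part H hQ hP hd.symm hX
      (by rw [Finset.union_comm]; exact hXs.1)
      ⟨v, Finset.mem_inter.2 ⟨hv, hvX⟩⟩ ⟨u, Finset.mem_sdiff.2 ⟨huX, huQ⟩⟩ hQX
    refine ⟨Q ∩ X, Q \ X, by ext a; simp; tauto, ?_, a2, a1, ?_, ?_⟩
    · rw [Finset.disjoint_left]; intro a; simp; tauto
    · rwa [Finset.union_comm]
    · intro Q' h1 h2 h3 h4
      rw [Finset.union_comm]
      exact a4 Q' h1 h2.symm h3.symm (by rwa [Finset.union_comm])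
  · left
    obtain ⟨a1, a2, a3, a4⟩ := split_part H hP hQ hd hX hXs.1
      ⟨u, Finset.mem_inter.2 ⟨hu, huX⟩⟩ ⟨v, Finset.mem_sdiff.2 ⟨hvX, hvP⟩⟩
      (Finset.sdiff_nonempty.2 hPX)
    refine ⟨P \ X, P ∩ X, by ext a; simp; tauto, ?_, a1, a2, a3, a4⟩
    rw [Finset.disjoint_left]; intro a; simp; tauto

/-- A good list: pairwise disjoint mincuts with consecutive unions mincuts. -/
def Good (w : V → V → ℝ) (r : V) (lam : ℝ) (L : List (Finset V)) : Prop :=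
  L.Pairwise (fun A B => Disjoint A B) ∧ (∀ A ∈ L, MC w r lam A) ∧
    L.IsChain (fun A B => MC w r lam (A ∪ B))

theorem chainUnion_append (L M : List (Finset V)) :
    chainUnion (L ++ M) = chainUnion L ∪ chainUnion M := by
  induction L with
  | nil => simp [chainUnion]
  | cons a L ih =>
    simp only [chainUnion, List.cons_append, List.foldr_cons] at ih ⊢
    rw [ih, Finset.union_assoc]

theorem chainUnion_cons (a : Finset V) (L : List (Finset V)) :
    chainUnion (a :: L) = a ∪ chainUnion L := rfl

theorem subset_chainUnion {a : Finset V} {L : List (Finset V)} (h : a ∈ L) :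
    a ⊆ chainUnion L := by
  induction L with
  | nil => simp at h
  | cons b L ih =>
    rw [chainUnion_cons]
    rcases List.mem_cons.1 h with rfl | h
    · exact Finset.subset_union_left
    · exact (ih h).trans Finset.subset_union_right

theorem disjoint_chainUnion {a : Finset V} {L : List (Finset V)}
    (h : ∀ b ∈ L, Disjoint a b) : Disjoint a (chainUnion L) := by
  induction L with
  | nil => simp [chainUnion]
  | cons b L ih =>
    rw [chainUnion_cons, Finset.disjoint_union_right]
    exact ⟨h b (by simp), ih fun c hc => h c (by simp [hc])⟩

theorem length_le_card {L : List (Finset V)} (h : L.Pairwise (fun A B => Disjoint A B))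
    (hne : ∀ A ∈ L, A.Nonempty) : L.length ≤ (chainUnion L).card := by
  induction L with
  | nil => simp
  | cons b L ih =>
    rw [List.pairwise_cons] at h
    rw [chainUnion_cons, Finset.card_union_of_disjoint (disjoint_chainUnion h.1)]
    have := ih h.2 fun A hA => hne A (by simp [hA])
    have := (hne b (by simp)).card_pos
    simp only [List.length_cons]
    omega

theorem good_split {w : V → V → ℝ} {r : V} {lam : ℝ} {S T : List (Finset V)}
    {P P₁ P₂ : Finset V} (hg : Good w r lam (S ++ P :: T)) (hU : P₁ ∪ P₂ = P)
    (hd : Disjoint P₁ P₂) (h1 : MC w r lam P₁) (h2 : MC w r lam P₂)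
    (hl : ∀ x ∈ S.getLast?, MC w r lam (x ∪ P₁)) (hr : ∀ y ∈ T.head?, MC w r lam (P₂ ∪ y)) :
    Good w r lam (S ++ P₁ :: P₂ :: T) := by
  obtain ⟨hp, hm, hc⟩ := hg
  have hP : MC w r lam (P₁ ∪ P₂) := hU ▸ hm P (by simp)
  have s1 : P₁ ⊆ P := hU ▸ Finset.subset_union_left
  have s2 : P₂ ⊆ P := hU ▸ Finset.subset_union_right
  refine ⟨?_, ?_, ?_⟩
  · rw [List.pairwise_append, List.pairwise_cons] at hp
    obtain ⟨p1, ⟨p2, p3⟩, p4⟩ := hp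
    rw [List.pairwise_append, List.pairwise_cons, List.pairwise_cons]
    refine ⟨p1, ⟨?_, fun a ha => (p2 a ha).mono_left s2, p3⟩, ?_⟩
    · intro a ha
      rcases List.mem_cons.1 ha with rfl | ha
      · exact hd
      · exact (p2 a ha).mono_left s1
    · intro a ha b hb
      have hPa := p4 a ha P (by simp)
      simp only [List.mem_cons] at hb
      rcases hb with rfl | rfl | hb
      · exact hPa.mono_right s1
      · exact hPa.mono_right s2
      · exact p4 a ha b (by simp [hb])
  · intro a ha
    simp only [List.mem_append, List.mem_cons] at ha
    rcases ha with ha | rfl | rfl | ha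
    · exact hm a (by simp [ha])
    · exact h1
    · exact h2
    · exact hm a (by simp [ha])
  · rw [List.isChain_append] at hc ⊢
    obtain ⟨c1, c2, -⟩ := hc
    rw [List.isChain_cons] at c2
    refine ⟨c1, ?_, ?_⟩
    · rw [List.isChain_cons_cons, List.isChain_cons]
      exact ⟨hP, hr, c2.2⟩
    · intro x hx y hy
      simp at hy
      exact hy ▸ hl x hx

/-- A good list that is not an edge-chain can be refined. -/
theorem exists_refine {w : V → V → ℝ} {r : V} {lam : ℝ} (H : Hyp w r lam)
    {L : List (Finset V)} (hg : Good w r lam L) (hn : ¬ L.IsChain (EdgeRel w r)) :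
    ∃ S T P P₁ P₂, L = S ++ P :: T ∧ P₁ ∪ P₂ = P ∧ Good w r lam (S ++ P₁ :: P₂ :: T) := by
  rw [List.isChain_iff_forall_rel_of_append_cons_cons] at hn
  push Not at hn
  obtain ⟨P, Q, S, T, rfl, hPQ⟩ := hn
  have hg' := hg
  obtain ⟨hp, hm, hc⟩ := hg
  rw [List.isChain_append_cons_cons] at hc
  obtain ⟨c1, c2, c3⟩ := hc
  rw [List.isChain_append] at c1
  rw [List.isChain_cons] at c3
  simp only [List.pairwise_append, List.pairwise_cons] at hp
  obtain ⟨p1, ⟨p2, p3, p4⟩, p5⟩ := hp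
  have hd := p2 Q (by simp)
  rcases refine_pair H (hm P (by simp)) (hm Q (by simp)) hd c2 hPQ with
    ⟨P₁, P₂, hU, d, m1, m2, m3, m4⟩ | ⟨Q₁, Q₂, hU, d, m1, m2, m3, m4⟩
  · refine ⟨S, Q :: T, P, P₁, P₂, rfl, hU, good_split hg' hU d m1 m2 ?_ ?_⟩
    · intro x hx
      have hxS := List.mem_of_mem_getLast? hx
      exact m4 x (hm x (by simp [hxS])) (p5 x hxS P (by simp)) (p5 x hxS Q (by simp))
        (c1.2.2 x hx P (by simp))
    · intro y hy
      simp at hy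
      exact hy ▸ m3
  · refine ⟨S ++ [P], T, Q, Q₁, Q₂, by simp, hU,
      good_split (P := Q) (by simpa using hg') hU d m1 m2 ?_ ?_⟩
    · intro x hx
      simp at hx
      exact hx ▸ m3
    · intro y hy
      have hyT := List.mem_of_mem_head? hy
      exact m4 y (hm y (by simp [hyT])) (p3 y hyT) (p2 y (by simp [hyT])) (c3.1 y hy)

theorem refine_all {w : V → V → ℝ} {r : V} {lam : ℝ} (H : Hyp w r lam) (n : ℕ) :
    ∀ L₁ L₂ : List (Finset V), Fintype.card V ≤ n + (L₁ ++ L₂).length →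
      Good w r lam (L₁ ++ L₂) →
    ∃ M₁ M₂ : List (Finset V), Good w r lam (M₁ ++ M₂) ∧ (M₁ ++ M₂).IsChain (EdgeRel w r) ∧
      chainUnion M₁ = chainUnion L₁ ∧ chainUnion M₂ = chainUnion L₂ ∧
      L₁.length ≤ M₁.length ∧ L₂.length ≤ M₂.length := by
  induction n with
  | zero =>
    intro L₁ L₂ hn hg
    by_cases hc : (L₁ ++ L₂).IsChain (EdgeRel w r)
    · exact ⟨L₁, L₂, hg, hc, rfl, rfl, le_rfl, le_rfl⟩
    · exfalso
      obtain ⟨S, T, P, P₁, P₂, e, -, hg'⟩ := exists_refine H hg hc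
      have h1 := length_le_card hg'.1 (fun A hA => (hg'.2.1 A hA).1)
      have h2 := Finset.card_le_univ (chainUnion (S ++ P₁ :: P₂ :: T))
      rw [e] at hn
      simp at h1 hn
      omega
  | succ n ih =>
    intro L₁ L₂ hn hg
    by_cases hc : (L₁ ++ L₂).IsChain (EdgeRel w r)
    · exact ⟨L₁, L₂, hg, hc, rfl, rfl, le_rfl, le_rfl⟩
    · obtain ⟨S, T, P, P₁, P₂, e, hU, hg'⟩ := exists_refine H hg hc
      have hlen := congrArg List.length e
      simp only [List.length_append, List.length_cons] at hlen hn
      rcases List.append_eq_append_iff.1 e with ⟨K, k1, k2⟩ | ⟨K, k1, k2⟩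
      · subst k1
        obtain ⟨M₁, M₂, g1, g2, g3, g4, g5, g6⟩ := ih L₁ (K ++ P₁ :: P₂ :: T)
          (by simp at hlen ⊢; omega) (by simpa using hg')
        refine ⟨M₁, M₂, g1, g2, g3, ?_, g5, ?_⟩
        · rw [g4, k2]
          simp only [chainUnion_append, chainUnion_cons, ← hU, Finset.union_assoc]
        · rw [k2]; simp at g6 ⊢; omega
      · cases K with
        | nil =>
          simp at k1 k2
          subst k1
          obtain ⟨M₁, M₂, g1, g2, g3, g4, g5, g6⟩ := ih L₁ (P₁ :: P₂ :: T)
            (by simp at hlen ⊢; omega) (by simpa using hg')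
          refine ⟨M₁, M₂, g1, g2, g3, ?_, g5, ?_⟩
          · rw [g4, ← k2]
            simp only [chainUnion_cons, ← hU, Finset.union_assoc]
          · rw [← k2]; simp at g6 ⊢; omega
        | cons P' K =>
          simp at k2
          obtain ⟨rfl, rfl⟩ := k2
          subst k1
          obtain ⟨M₁, M₂, g1, g2, g3, g4, g5, g6⟩ := ih (S ++ P₁ :: P₂ :: K) L₂
            (by simp at hn ⊢; omega) (by simpa using hg')
          refine ⟨M₁, M₂, g1, g2, ?_, g4, ?_, g6⟩
          · rw [g3]
            simp only [chainUnion_append, chainUnion_cons, ← hU, Finset.union_assoc]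
          · simp at g5 ⊢; omega

theorem key {w : V → V → ℝ} {r : V} {lam : ℝ} (H : Hyp w r lam) {A B : Finset V}
    (hA : MC w r lam A) (hB : MC w r lam B) (h1 : (A ∩ B).Nonempty) (h2 : (A \ B).Nonempty)
    (h3 : (B \ A).Nonempty) :
    ∃ M₁ M₂ : List (Finset V), Good w r lam (M₁ ++ M₂) ∧ (M₁ ++ M₂).IsChain (EdgeRel w r) ∧
      chainUnion M₁ = A ∧ chainUnion M₂ = B \ A ∧ 2 ≤ M₁.length ∧ 1 ≤ M₂.length := by
  obtain ⟨m1, m2, m3, m4, -, -⟩ := MC.cross H hA hB h1 h2 h3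
  have eA : A \ B ∪ A ∩ B = A := by ext a; simp; tauto
  have eB : A ∩ B ∪ B \ A = B := by ext a; simp; tauto
  have hg : Good w r lam ([A \ B, A ∩ B] ++ [B \ A]) := by
    refine ⟨?_, ?_, ?_⟩
    · simp only [List.cons_append, List.nil_append, List.pairwise_cons]
      simp only [Finset.disjoint_left]
      simp
      tauto
    · simp; exact ⟨m2, m1, m3⟩
    · simp [eA, eB]; exact ⟨hA, hB⟩
  obtain ⟨M₁, M₂, g1, g2, g3, g4, g5, g6⟩ := refine_all H (Fintype.card V) _ _ (by omega) hg
  refine ⟨M₁, M₂, g1, g2, ?_, ?_, g5, g6⟩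
  · rw [g3]; simp [chainUnion, eA]
  · rw [g4]; simp [chainUnion]

theorem chain_of {w : V → V → ℝ} {r : V} {lam : ℝ} {L : List (Finset V)}
    (hg : Good w r lam L) (he : L.IsChain (EdgeRel w r)) (hl : 2 ≤ L.length)
    (hcert : ∀ A ∈ L, HasCert w r A) : IsMincutChain w r L := by
  refine ⟨hl, fun A hA => (hg.2.1 A hA).1, fun A hA => (hg.2.1 A hA).2.1, hg.1, hcert, ?_⟩
  intro i h
  exact List.isChain_iff_getElem.1 he i h

theorem card_lt_of_mem {L : List (Finset V)} (h : L.Pairwise (fun A B => Disjoint A B))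
    (hne : ∀ A ∈ L, A.Nonempty) (hl : 2 ≤ L.length) {a : Finset V} (ha : a ∈ L) :
    a.card < (chainUnion L).card := by
  obtain ⟨S, T, rfl⟩ := List.append_of_mem ha
  have hp : (a :: (S ++ T)).Pairwise (fun A B => Disjoint A B) :=
    (List.Perm.pairwise_iff (fun h => h.symm) List.perm_middle).1 h
  rw [List.pairwise_cons] at hp
  have e : chainUnion (S ++ a :: T) = a ∪ chainUnion (S ++ T) := by
    simp only [chainUnion_append, chainUnion_cons]
    ext x; simp; tauto
  rw [e, Finset.card_union_of_disjoint (disjoint_chainUnion hp.1)]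
  have := length_le_card hp.2 (fun A hA => hne A (by
    simp only [List.mem_append, List.mem_cons] at hA ⊢; tauto))
  simp at hl this
  omega

/-- Every mincut avoiding the root has a certificate. -/
theorem hasCert {w : V → V → ℝ} {r : V} {lam : ℝ} (H : Hyp w r lam) (n : ℕ) :
    ∀ X : Finset V, X.card ≤ n → MC w r lam X → HasCert w r X := by
  induction n with
  | zero =>
    intro X hn hX
    have := hX.1.card_pos
    omega
  | succ n ih =>
    intro X hn hX
    by_contra hno
    obtain ⟨v, hv⟩ := hX.1
    obtain ⟨Y, hY, hYX⟩ := exists_smaller_vertex H hX hv (fun h => hno (.vertex h))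
    classical
    obtain ⟨D, hD, hmax⟩ := Finset.exists_max_image
      (Finset.univ.powerset.filter fun D : Finset V => MC w r lam D ∧ D ⊂ X) Finset.card
      ⟨Y, by simp [hY, hYX]⟩
    simp at hD hmax
    obtain ⟨hD, hDX⟩ := hD
    have hne : (X \ D).Nonempty := Finset.sdiff_nonempty.2 hDX.2
    have hdis : Disjoint D (X \ D) := Finset.disjoint_sdiff
    have c := cutVal_union H hdis
    rw [Finset.union_sdiff_of_subset hDX.1, hX.2.2, hD.2.2] at c
    have l := H.le _ hne (by simp [hX.2.1])
    have hp := H.pos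
    obtain ⟨u, hu, u', hu', he⟩ := exists_edge H hdis (by linarith)
    rw [Finset.mem_sdiff] at hu'
    obtain ⟨E, hE, hEX, huE, huE'⟩ := exists_smaller_edge H hX (hDX.1 hu) hu'.1 he
      (fun h => hno (.edge h))
    have hDE : (D \ E).Nonempty := by
      rw [Finset.sdiff_nonempty]
      intro hs
      have := hmax E hE hEX
      have := Finset.card_lt_card (Finset.ssubset_iff_subset_ne.2
        ⟨hs, by rintro rfl; exact hu'.2 huE'⟩)
      omega
    have hint : (D ∩ E).Nonempty := ⟨u, Finset.mem_inter.2 ⟨hu, huE⟩⟩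
    have hED : (E \ D).Nonempty := ⟨u', Finset.mem_sdiff.2 ⟨huE', hu'.2⟩⟩
    have hDEm := (MC.cross H hD hE hint hDE hED).2.2.2.1
    have hU : D ∪ E = X := by
      by_contra hneq
      have h1 := hmax (D ∪ E) hDEm (Finset.ssubset_iff_subset_ne.2
        ⟨Finset.union_subset hDX.1 hEX.1, hneq⟩)
      have h2 := Finset.card_lt_card (Finset.ssubset_iff_subset_ne.2
        ⟨Finset.subset_union_left (s₁ := D) (s₂ := E), by
          intro h
          exact hu'.2 (h ▸ Finset.mem_union_right _ huE')⟩)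
      omega
    obtain ⟨M₁, M₂, g1, g2, g3, g4, g5, g6⟩ := key H hD hE hint hDE hED
    have hl : 2 ≤ (M₁ ++ M₂).length := by simp; omega
    have hXu : chainUnion (M₁ ++ M₂) = X := by
      rw [chainUnion_append, g3, g4, Finset.union_sdiff_self_eq_union, hU]
    have hch := chain_of g1 g2 hl (fun A hA => by
      have := card_lt_of_mem g1.1 (fun A hA => (g1.2.1 A hA).1) hl hA
      rw [hXu] at this
      exact ih A (by omega) (g1.2.1 A hA))
    obtain ⟨q1, q2, q3, q4, q5, q6⟩ := hch
    exact hno (hXu ▸ HasCert.chain q1 q2 q3 q4 q5 q6)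

/-- the collection of mincuts `X` with `r ∉ X` that have no chain
certificate, or all of whose chain certificates are maximal chains, is laminar. -/
theorem collection_laminar
    (r : V) (w : V → V → ℝ)
    (hcard : 1 < Fintype.card V)
    (hsym : ∀ x y, w x y = w y x)
    (hnonneg : ∀ x y, 0 ≤ w x y)
    (hdiag : ∀ x, w x x = 0)
    (lam : ℝ) (hlam : IsMincutValue w lam) (hpos : 0 < lam)
    (A B : Finset V)
    (hA : IsMincut w A ∧ r ∉ A ∧
      ((¬ ∃ C : List (Finset V), IsMincutChain w r C ∧ chainUnion C = A) ∨
        (∀ C : List (Finset V), IsMincutChain w r C → chainUnion C = A → IsMaximalMincutChain w r C)))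
    (hB : IsMincut w B ∧ r ∉ B ∧
      ((¬ ∃ C : List (Finset V), IsMincutChain w r C ∧ chainUnion C = B) ∨
        (∀ C : List (Finset V), IsMincutChain w r C → chainUnion C = B → IsMaximalMincutChain w r C))) :
    A ⊆ B ∨ B ⊆ A ∨ Disjoint A B := by
  have H := hyp_of r w hsym hnonneg lam hlam hpos
  by_contra hcon
  push Not at hcon
  obtain ⟨n1, n2, n3⟩ := hcon
  have mA : MC w r lam A := ⟨hA.1.1.1, hA.2.1, ((H.mc A hA.2.1).1 hA.1).2⟩
  have mB : MC w r lam B := ⟨hB.1.1.1, hB.2.1, ((H.mc B hB.2.1).1 hB.1).2⟩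
  obtain ⟨M₁, M₂, g1, g2, g3, g4, g5, g6⟩ := key H mA mB
    (Finset.not_disjoint_iff_nonempty_inter.1 n3) (Finset.sdiff_nonempty.2 n1)
    (Finset.sdiff_nonempty.2 n2)
  have hcert : ∀ X ∈ M₁ ++ M₂, HasCert w r X := fun X hX =>
    hasCert H _ X le_rfl (g1.2.1 X hX)
  have hbig : IsMincutChain w r (M₁ ++ M₂) := chain_of g1 g2 (by simp; omega) hcert
  have hg1 : Good w r lam M₁ :=
    ⟨(List.pairwise_append.1 g1.1).1, fun X hX => g1.2.1 X (by simp [hX]),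
      g1.2.2.left_of_append⟩
  have hsmall : IsMincutChain w r M₁ :=
    chain_of hg1 g2.left_of_append g5 fun X hX => hcert X (by simp [hX])
  rcases hA.2.2 with h | h
  · exact h ⟨M₁, hsmall, g3⟩
  · refine (h M₁ hsmall g3).2 ⟨M₁ ++ M₂, hbig, by simp; omega, Or.inl ⟨[], M₂, by simp⟩⟩
end

section
/- Let X be a mincut with r ∉ X that is not the minimal mincut of any edge, and let A be a mincut with A ⊊ X that is maximal among mincuts properly contained in X (i.e., there is no mincut Z with A ⊊ Z ⊊ X). Let e = {x,y} be an edge with x ∈ A and y ∈ X ∖ A, and let X_e be the minimal mincut of e (it exists, since X is a mincut containing x and y but not r). Then X_e crosses A, X_e ∪ A = X, and consequently X ∖ A is a mincut. -/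
open Finset

variable {V : Type*} [Fintype V] [DecidableEq V]

lemma cutVal_eq_ite (w : V → V → ℝ) (X : Finset V) :
    cutVal w X = ∑ a, ∑ b, if a ∈ X ∧ b ∉ X then w a b else 0 := by
  unfold cutVal cutW
  rw [← Finset.sum_filter_add_sum_filter_not Finset.univ (fun a => a ∈ X)]
  have h2 : ∑ a with a ∉ X, ∑ b, (if a ∈ X ∧ b ∉ X then w a b else 0) = 0 := by
    apply Finset.sum_eq_zero
    intro a ha
    apply Finset.sum_eq_zero
    intro b _
    simp at ha
    simp [ha]
  rw [h2, add_zero]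
  have h3 : (Finset.univ.filter (fun a => a ∈ X)) = X := by ext; simp
  rw [h3]
  apply Finset.sum_congr rfl
  intro a ha
  have h4 : Xᶜ = Finset.univ.filter (fun b => b ∉ X) := by ext; simp
  rw [h4, Finset.sum_filter]
  simp [ha]

lemma cutVal_submod (w : V → V → ℝ) (hnonneg : ∀ x y, 0 ≤ w x y) (X Y : Finset V) :
    cutVal w (X ∩ Y) + cutVal w (X ∪ Y) ≤ cutVal w X + cutVal w Y := by
  simp only [cutVal_eq_ite, ← Finset.sum_add_distrib]
  apply Finset.sum_le_sum
  intro a _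
  apply Finset.sum_le_sum
  intro b _
  have := hnonneg a b
  by_cases h1 : a ∈ X <;> by_cases h2 : a ∈ Y <;> by_cases h3 : b ∈ X <;>
    by_cases h4 : b ∈ Y <;> simp [h1, h2, h3, h4, this]

lemma cutVal_compl (w : V → V → ℝ) (hsym : ∀ x y, w x y = w y x) (X : Finset V) :
    cutVal w Xᶜ = cutVal w X := by
  unfold cutVal cutW
  rw [compl_compl, Finset.sum_comm]
  simp only [hsym]

lemma cutVal_posimod (w : V → V → ℝ) (hsym : ∀ x y, w x y = w y x)
    (hnonneg : ∀ x y, 0 ≤ w x y) (X Y : Finset V) :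
    cutVal w (X \ Y) + cutVal w (Y \ X) ≤ cutVal w X + cutVal w Y := by
  have h := cutVal_submod w hnonneg X Yᶜ
  have e1 : X ∩ Yᶜ = X \ Y := by ext; simp
  have e2 : X ∪ Yᶜ = (Y \ X)ᶜ := by ext; simp; tauto
  rw [e1, e2, cutVal_compl w hsym, cutVal_compl w hsym] at h
  exact h

lemma mincut_of_add_le (w : V → V → ℝ) {X Y P Q : Finset V}
    (hX : IsMincut w X) (hY : IsMincut w Y) (hP : IsCut P) (hQ : IsCut Q)
    (h : cutVal w P + cutVal w Q ≤ cutVal w X + cutVal w Y) :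
    IsMincut w P ∧ IsMincut w Q := by
  have h1 := hX.2 P hP
  have h2 := hY.2 Q hQ
  have h3 := hX.2 Q hQ
  have h4 := hY.2 P hP
  refine ⟨⟨hP, fun Z hZ => ?_⟩, ⟨hQ, fun Z hZ => ?_⟩⟩
  · have := hX.2 Z hZ
    linarith
  · have := hY.2 Z hZ
    linarith

lemma isCut_of_mem {X : Finset V} {a b : V} (ha : a ∈ X) (hb : b ∉ X) : IsCut X :=
  ⟨⟨a, ha⟩, fun h => hb (h ▸ Finset.mem_univ b)⟩

/-- if the mincut `X` (with `r ∉ X`) is not the minimal mincut of any edge,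
`A ⊊ X` is a mincut maximal among mincuts properly contained in `X`, and `e = {x,y}` is an
edge with `x ∈ A`, `y ∈ X ∖ A`, with minimal mincut `Xe`, then `Xe` crosses `A`,
`Xe ∪ A = X`, and `X ∖ A` is a mincut. -/
theorem extendable_maximal_sub_mincut
    (r : V) (w : V → V → ℝ)
    (hcard : 1 < Fintype.card V)
    (hsym : ∀ x y, w x y = w y x)
    (hnonneg : ∀ x y, 0 ≤ w x y)
    (hdiag : ∀ x, w x x = 0)
    (X : Finset V) (hX : IsMincut w X) (hrX : r ∉ X)
    (hnotedge : ¬ ∃ u₁ u₂ : V, IsMinimalMincutOfEdge w r u₁ u₂ X)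
    (A : Finset V) (hA : IsMincut w A) (hAX : A ⊂ X)
    (hmax : ¬ ∃ Z : Finset V, IsMincut w Z ∧ A ⊂ Z ∧ Z ⊂ X)
    (x y : V) (hx : x ∈ A) (hy : y ∈ X \ A) (hedge : IsEdge w x y)
    (Xe : Finset V) (hXe : IsMinimalMincutOfEdge w r x y Xe) :
    Crosses Xe A ∧ Xe ∪ A = X ∧ IsMincut w (X \ A) := by
  obtain ⟨hyX, hyA⟩ := Finset.mem_sdiff.mp hy
  have hxX := hAX.1 hx
  have hrA : r ∉ A := fun h => hrX (hAX.1 h)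
  have hXe0 := hXe
  obtain ⟨-, hM, hxe, hye, hre, hmin⟩ := hXe
  have hru : r ∉ Xe ∪ X := by simp [hre, hrX]
  have hri : r ∉ Xe ∩ X := by simp [hre]
  have hI : IsMincut w (Xe ∩ X) :=
    (mincut_of_add_le w hM hX
      (isCut_of_mem (Finset.mem_inter.2 ⟨hxe, hxX⟩) hri)
      (isCut_of_mem (Finset.mem_union_left _ hxe) hru)
      (cutVal_submod w hnonneg Xe X)).1
  have hsub : Xe ⊆ X := by
    have hc := hmin _ hI (Finset.mem_inter.2 ⟨hxe, hxX⟩) (Finset.mem_inter.2 ⟨hye, hyX⟩) hri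
    have := Finset.eq_of_subset_of_card_le Finset.inter_subset_left hc
    exact Finset.inter_eq_left.1 this
  have hne : Xe ≠ X := fun h => hnotedge ⟨x, y, h ▸ hXe0⟩
  have hAXe : (A \ Xe).Nonempty := by
    rw [Finset.sdiff_nonempty]
    intro h
    exact hmax ⟨Xe, hM, ⟨h, fun h' => hyA (h' hye)⟩,
      Finset.ssubset_iff_subset_ne.2 ⟨hsub, hne⟩⟩
  have hrU : r ∉ Xe ∪ A := by simp [hre, hrA]
  have hU : IsMincut w (Xe ∪ A) :=
    (mincut_of_add_le w hM hA
      (isCut_of_mem (Finset.mem_inter.2 ⟨hxe, hx⟩) (fun h => hre (Finset.mem_inter.1 h).1))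
      (isCut_of_mem (Finset.mem_union_left _ hxe) hrU)
      (cutVal_submod w hnonneg Xe A)).2
  have hUX : Xe ∪ A = X := by
    by_contra h
    exact hmax ⟨_, hU, ⟨Finset.subset_union_right,
      fun h' => hyA (h' (Finset.mem_union_left _ hye))⟩,
      Finset.ssubset_iff_subset_ne.2 ⟨Finset.union_subset hsub hAX.1, h⟩⟩
  refine ⟨⟨⟨x, Finset.mem_inter.2 ⟨hxe, hx⟩⟩, ⟨y, Finset.mem_sdiff.2 ⟨hye, hyA⟩⟩, hAXe,
    ⟨r, Finset.mem_compl.2 hrU⟩⟩, hUX, ?_⟩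
  have hd : X \ A = Xe \ A := by
    rw [← hUX]; ext; simp; tauto
  rw [hd]
  obtain ⟨z, hz⟩ := hAXe
  exact (mincut_of_add_le w hM hA
      (isCut_of_mem (Finset.mem_sdiff.2 ⟨hye, hyA⟩) (fun h => hre (Finset.mem_sdiff.1 h).1))
      (isCut_of_mem hz (fun h => hrA (Finset.mem_sdiff.1 h).1))
      (cutVal_posimod w hsym hnonneg Xe A)).1
end

section
/- Let T be a finite tree rooted at r and let 𝒫 be a path decomposition of T. Let v and w be incomparable vertices (neither is an ancestor of the other) lying on distinct paths P_v, P_w ∈ 𝒫. Then v ∉ P_w^↓ or w ∉ P_v^↓; in fact, either P_v ∩ P_w^↓ = ∅ or P_w ∩ P_v^↓ = ∅. -/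
open Finset

variable {V : Type*} [Fintype V] [DecidableEq V]

/-- `Anc par u v` : `u` is an ancestor of `v` in the rooted tree with parent map `par`
(the ancestor relation is reflexive). -/
def Anc (par : V → V) (u v : V) : Prop :=
  Relation.ReflTransGen (fun a b => b = par a) v u

open scoped Classical

/-- `P^↓`: the set of vertices having at least one ancestor in `P`. -/
noncomputable def pathDown (par : V → V) (P : Finset V) : Finset V :=
  Finset.univ.filter (fun v => ∃ u ∈ P, Anc par u v)

/-- An oriented path on the tree: its vertex set is exactly the set of vertices between
some vertex `a` and some ancestor `b` of `a` (so the vertex closest to the root is an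
endpoint, and the vertex set is totally ordered by the ancestor relation). -/
def IsOrientedPath (par : V → V) (P : Finset V) : Prop :=
  ∃ a b : V, Anc par b a ∧
    P = Finset.univ.filter (fun x => Anc par b x ∧ Anc par x a)

/-- in a path decomposition `Ps` of a finite rooted tree, if `v` and `w` are
incomparable vertices lying on distinct paths `Pv, Pw ∈ Ps`, then `v ∉ Pw^↓` or
`w ∉ Pv^↓`; in fact `Pv ∩ Pw^↓ = ∅` or `Pw ∩ Pv^↓ = ∅`. -/
theorem path_decomposition_outer
    (r : V) (par : V → V) (dep : V → ℕ)
    (hpar_r : par r = r)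
    (hdep : ∀ v : V, v ≠ r → dep v = dep (par v) + 1)
    (hdep0 : ∀ v : V, dep v = 0 → v = r)
    (Ps : Finset (Finset V))
    (hpaths : ∀ P ∈ Ps, IsOrientedPath par P)
    (hcover : ∀ v : V, ∃! P : Finset V, P ∈ Ps ∧ v ∈ P)
    (v w : V) (hvw : ¬ Anc par v w ∧ ¬ Anc par w v)
    (Pv Pw : Finset V) (hPv : Pv ∈ Ps) (hPw : Pw ∈ Ps)
    (hv : v ∈ Pv) (hw : w ∈ Pw) (hne : Pv ≠ Pw) :
    (v ∉ pathDown par Pw ∨ w ∉ pathDown par Pv) ∧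
    (Pv ∩ pathDown par Pw = ∅ ∨ Pw ∩ pathDown par Pv = ∅) := by
  have key : Pv ∩ pathDown par Pw = ∅ ∨ Pw ∩ pathDown par Pv = ∅ := by
    by_contra hcon
    push Not at hcon
    obtain ⟨h1, h2⟩ := hcon
    obtain ⟨x, hx⟩ := Finset.nonempty_iff_ne_empty.mpr (by simpa [Finset.nonempty_iff_ne_empty] using h1)
    obtain ⟨y, hy⟩ := Finset.nonempty_iff_ne_empty.mpr (by simpa [Finset.nonempty_iff_ne_empty] using h2)
    obtain ⟨hxv, hxd⟩ := Finset.mem_inter.mp hx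
    obtain ⟨hyw, hyd⟩ := Finset.mem_inter.mp hy
    obtain ⟨u, hu, hux⟩ := (Finset.mem_filter.mp hxd).2
    obtain ⟨t, ht, hty⟩ := (Finset.mem_filter.mp hyd).2
    obtain ⟨a, b, hba, hPa⟩ := hpaths Pv hPv
    obtain ⟨c, d, hdc, hPc⟩ := hpaths Pw hPw
    have memv : ∀ z, z ∈ Pv ↔ Anc par b z ∧ Anc par z a := by intro z; rw [hPa]; simp
    have memw : ∀ z, z ∈ Pw ↔ Anc par d z ∧ Anc par z c := by intro z; rw [hPc]; simp
    have tr : ∀ {p q s : V}, Anc par p q → Anc par q s → Anc par p s :=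
      fun h h' => Relation.ReflTransGen.trans h' h
    have disj : ∀ z, z ∈ Pv → z ∈ Pw → False := fun z hz hz' =>
      hne ((hcover z).unique ⟨hPv, hz⟩ ⟨hPw, hz'⟩)
    have hbx := ((memv x).1 hxv).1
    have hxa := ((memv x).1 hxv).2
    have hyc := ((memw y).1 hyw).2
    have hdx : Anc par d x := tr ((memw u).1 hu).1 hux
    have hby : Anc par b y := tr ((memv t).1 ht).1 hty
    have tot : Anc par d b ∨ Anc par b d :=
      Relation.ReflTransGen.total_of_right_unique
        (fun p q s h h' => by rw [h, h']) hbx hdx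
    rcases tot with h | h
    · exact disj b ((memv b).2 ⟨Relation.ReflTransGen.refl, hba⟩) ((memw b).2 ⟨h, tr hby hyc⟩)
    · exact disj d ((memv d).2 ⟨h, tr hdx hxa⟩) ((memw d).2 ⟨Relation.ReflTransGen.refl, hdc⟩)
  refine ⟨?_, key⟩
  rcases key with h | h
  · left
    intro hm
    have := Finset.mem_inter.mpr ⟨hv, hm⟩
    simp [h] at this
  · right
    intro hm
    have := Finset.mem_inter.mpr ⟨hw, hm⟩
    simp [h] at this
end
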